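/- arXiv:1304.7443 — 2 statements merged into one kernel-verified Lean document; each statement's English description precedes it below -/
import Mathlib

section
/- Let N ≥ 4 be an integer, σ, β, ε > 0 and C₀ > 0. Let φ : [0,1/2] → ℝ be continuously differentiable and monotonically increasing with φ(0) = 0, φ(1/2) = ln N and φ'(t) ≤ C₀ N for all t ∈ [0,1/2], and set ψ := e^{−φ}. Define mesh points x_i := (σε/β) φ(i/N) for i = 0,…,N/2 and step sizes h_i := x_i − x_{i−1}. Then there is a constant C depending only on σ, β and C₀ (independent of ε and N; one may take C = (σ/β) e^{C₀}) such that for all 1 ≤ i ≤ N/2 and all x ∈ [x_{i−1}, x_i]: h_i ≤ C ε N^{−1} (max_{t∈[0,1/2]} |ψ'(t)|) e^{β x/(σ ε)}. -/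
/-- If `φ` is monotone with `φ' ≤ K` and `|(e^{−φ})'| ≤ M` on `[l, u]`, then the increment of `φ`
over `[a, b] ⊆ [l, u]` is at most `(b - a) M e^{φ(a) + K (b - a)}`. -/
theorem MonotoneOn.sub_le_mul_exp_of_abs_derivWithin_exp_neg_le {φ : ℝ → ℝ} {l u a b K M : ℝ}
    (hφ : DifferentiableOn ℝ φ (Set.Icc l u)) (hmono : MonotoneOn φ (Set.Icc l u))
    (hla : l ≤ a) (hab : a < b) (hbu : b ≤ u)
    (hK : ∀ t ∈ Set.Icc l u, derivWithin φ (Set.Icc l u) t ≤ K)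
    (hM : ∀ t ∈ Set.Icc l u, |derivWithin (fun s => Real.exp (-φ s)) (Set.Icc l u) t| ≤ M) :
    φ b - φ a ≤ (b - a) * M * Real.exp (φ a + K * (b - a)) := by
  have hsub : Set.Icc a b ⊆ Set.Icc l u := Set.Icc_subset_Icc hla hbu
  have hderiv (t : ℝ) (ht : t ∈ Set.Ioo a b) :
      HasDerivAt φ (derivWithin φ (Set.Icc l u) t) t :=
    (hφ t (hsub ⟨ht.1.le, ht.2.le⟩)).hasDerivWithinAt.hasDerivAt
      (Icc_mem_nhds (hla.trans_lt ht.1) (ht.2.trans_le hbu))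
  obtain ⟨c, hc, hslope⟩ := exists_hasDerivAt_eq_slope φ (derivWithin φ (Set.Icc l u)) hab
    (hφ.continuousOn.mono hsub) hderiv
  have hcI : c ∈ Set.Icc l u := hsub ⟨hc.1.le, hc.2.le⟩
  have hba : 0 < b - a := sub_pos.2 hab
  rw [eq_div_iff hba.ne'] at hslope
  have hψ : derivWithin (fun s => Real.exp (-φ s)) (Set.Icc l u) c =
      Real.exp (-φ c) * -derivWithin φ (Set.Icc l u) c :=
    ((hφ c hcI).hasDerivWithinAt.neg.exp).derivWithin
      (uniqueDiffOn_Icc ((hla.trans_lt hab).trans_le hbu) c hcI)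
  have hφ'M : derivWithin φ (Set.Icc l u) c ≤ M * Real.exp (φ c) := by
    have h := (neg_le_abs _).trans (hM c hcI)
    rw [hψ, mul_neg, neg_neg, Real.exp_neg, inv_mul_eq_div] at h
    exact (div_le_iff₀ (Real.exp_pos _)).1 h
  have hM0 : 0 ≤ M := (abs_nonneg _).trans (hM c hcI)
  have hφc : φ c ≤ φ a + K * (b - a) := by
    have h₁ := hmono hcI (hsub ⟨hab.le, le_rfl⟩) hc.2.le
    have h₂ := mul_le_mul_of_nonneg_right (hK c hcI) hba.le
    linarith
  calc φ b - φ a = (b - a) * derivWithin φ (Set.Icc l u) c := by rw [← hslope, mul_comm]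
    _ ≤ (b - a) * (M * Real.exp (φ a + K * (b - a))) := by
      gcongr
      exact hφ'M.trans (by gcongr)
    _ = _ := by ring


/-- For an S-type mesh with mesh-generating function `φ` (continuously differentiable,
monotone, `φ 0 = 0`, `φ (1/2) = ln N`, `φ' ≤ C₀ N`) and mesh-characterising function
`ψ = e^{−φ}`, the fine mesh steps `h_i = x_i − x_{i−1}`, `x_i = (σε/β) φ(i/N)`, satisfy
`h_i ≤ C ε N⁻¹ (max |ψ'|) e^{βx/(σε)}` for all `x ∈ [x_{i−1}, x_i]`, with a constant `C`
depending only on `σ`, `β` and `C₀`. -/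
theorem stype_mesh_step_bound (σ β C₀ : ℝ) (hσ : 0 < σ) (hβ : 0 < β) (hC₀ : 0 < C₀) :
    ∃ C : ℝ, 0 < C ∧
      ∀ N : ℕ, 4 ≤ N → ∀ ε : ℝ, 0 < ε →
      ∀ φ : ℝ → ℝ,
        ContDiffOn ℝ 1 φ (Set.Icc 0 (1 / 2)) →
        MonotoneOn φ (Set.Icc 0 (1 / 2)) →
        φ 0 = 0 → φ (1 / 2) = Real.log N →
        (∀ t ∈ Set.Icc (0 : ℝ) (1 / 2), derivWithin φ (Set.Icc 0 (1 / 2)) t ≤ C₀ * N) →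
      ∀ M : ℝ,
        IsGreatest
          ((fun t => |derivWithin (fun s => Real.exp (-φ s)) (Set.Icc 0 (1 / 2)) t|) ''
            Set.Icc (0 : ℝ) (1 / 2)) M →
      ∀ i : ℕ, 1 ≤ i → i ≤ N / 2 →
      ∀ x ∈ Set.Icc (σ * ε / β * φ (((i : ℝ) - 1) / N)) (σ * ε / β * φ ((i : ℝ) / N)),
        σ * ε / β * φ ((i : ℝ) / N) - σ * ε / β * φ (((i : ℝ) - 1) / N) ≤
          C * ε * (N : ℝ)⁻¹ * M * Real.exp (β * x / (σ * ε)) := by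
  refine ⟨σ / β * Real.exp C₀, by positivity, ?_⟩
  intro N hN ε hε φ hφ hmono _ _ hbound M hM i hi hiN x hx
  have hN0 : (0 : ℝ) < N := by exact_mod_cast (by omega : 0 < N)
  have hi1 : (1 : ℝ) ≤ i := by exact_mod_cast hi
  have hi2 : (i : ℝ) * 2 ≤ N := by exact_mod_cast (by omega : i * 2 ≤ N)
  have hlen : (i : ℝ) / N - ((i : ℝ) - 1) / N = (N : ℝ)⁻¹ := by field_simp; ring
  have hstep := hmono.sub_le_mul_exp_of_abs_derivWithin_exp_neg_le
    (hφ.differentiableOn one_ne_zero) (div_nonneg (sub_nonneg.2 hi1) hN0.le)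
    (sub_pos.1 (hlen ▸ inv_pos.2 hN0)) (by rw [div_le_div_iff₀ hN0 two_pos]; linarith)
    hbound fun t ht => hM.2 ⟨t, ht, rfl⟩
  rw [hlen, mul_inv_cancel_right₀ hN0.ne'] at hstep
  have hM0 : 0 ≤ M := by
    obtain ⟨t, _, rfl⟩ := hM.1
    exact abs_nonneg _
  have hφx : φ (((i : ℝ) - 1) / N) ≤ β * x / (σ * ε) := by
    rw [le_div_iff₀ (by positivity)]
    calc φ (((i : ℝ) - 1) / N) * (σ * ε) = β * (σ * ε / β * φ (((i : ℝ) - 1) / N)) := by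
          field_simp
      _ ≤ β * x := by gcongr; exact hx.1
  calc σ * ε / β * φ ((i : ℝ) / N) - σ * ε / β * φ (((i : ℝ) - 1) / N)
      = σ * ε / β * (φ ((i : ℝ) / N) - φ (((i : ℝ) - 1) / N)) := by ring
    _ ≤ σ * ε / β * ((N : ℝ)⁻¹ * M * Real.exp (β * x / (σ * ε) + C₀)) := by
      gcongr
      exact hstep.trans (by gcongr)
    _ = _ := by rw [Real.exp_add]; ring
end

section
/- Let p ≥ 2 be an integer. For every continuous function v on the reference element τ̂ = [−1,1]² one has π̂_p v = Î_p (π̂_{p+1} v), where π̂_p and π̂_{p+1} are the vertex-edge-cell interpolants into Q_p(τ̂) and Q_{p+1}(τ̂) respectively, and Î_p is the Gauß–Lobatto interpolant into Q_p(τ̂). -/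
/-- The Legendre polynomial of degree `p`, given by Rodrigues' formula
`L_p(t) = (1/(2^p p!)) (d/dt)^p (t² − 1)^p`. -/
noncomputable def legendre (p : ℕ) : Polynomial ℝ :=
  Polynomial.C (1 / (2 ^ p * (Nat.factorial p) : ℝ)) *
    Polynomial.derivative^[p] ((Polynomial.X ^ 2 - 1) ^ p)

/-- The Gauß–Lobatto points of order `p`: `−1 = t_0 < t_1 < ⋯ < t_p = 1`, the zeros of
`(1 − t²) L_p'(t)`. -/
def IsGLNodes (p : ℕ) (t : Fin (p + 1) → ℝ) : Prop :=
  StrictMono t ∧ t 0 = -1 ∧ t (Fin.last p) = 1 ∧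
    ∀ i, (1 - t i ^ 2) * (Polynomial.derivative (legendre p)).eval (t i) = 0

/-- Evaluation of a bivariate polynomial at a point of `ℝ²`. -/
noncomputable def ev (q : MvPolynomial (Fin 2) ℝ) (z : ℝ × ℝ) : ℝ :=
  MvPolynomial.eval ![z.1, z.2] q

/-- `q ∈ Q_k`: degree at most `k` in each of the two variables. -/
def memQ (k : ℕ) (q : MvPolynomial (Fin 2) ℝ) : Prop :=
  q.degreeOf 0 ≤ k ∧ q.degreeOf 1 ≤ k

/-- The reference element `τ̂ = [−1,1]²`. -/
def refSq : Set (ℝ × ℝ) := Set.Icc (-1, -1) (1, 1)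

/-- `q` is the vertex-edge-cell interpolant of `v` into `Q_k(τ̂)`: it matches `v` at the
four vertices of `τ̂ = [−1,1]²`, has the same moments against `P_{k−2}` on each of the
four edges, and the same moments against `Q_{k−2}` on the cell. -/
def IsVEC (k : ℕ) (v : ℝ × ℝ → ℝ) (q : MvPolynomial (Fin 2) ℝ) : Prop :=
  memQ k q ∧
  (∀ a ∈ ({-1, 1} : Set ℝ), ∀ b ∈ ({-1, 1} : Set ℝ), ev q (a, b) = v (a, b)) ∧
  (∀ b ∈ ({-1, 1} : Set ℝ), ∀ r : Polynomial ℝ, r.natDegree ≤ k - 2 →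
    ∫ s in (-1 : ℝ)..1, (ev q (s, b) - v (s, b)) * r.eval s = 0) ∧
  (∀ a ∈ ({-1, 1} : Set ℝ), ∀ r : Polynomial ℝ, r.natDegree ≤ k - 2 →
    ∫ s in (-1 : ℝ)..1, (ev q (a, s) - v (a, s)) * r.eval s = 0) ∧
  (∀ r : MvPolynomial (Fin 2) ℝ, memQ (k - 2) r →
    ∫ x in (-1 : ℝ)..1, ∫ y in (-1 : ℝ)..1, (ev q (x, y) - v (x, y)) * ev r (x, y) = 0)

/-- `q ∈ Q_k(τ̂)` is the tensor-product Lagrange interpolant of `v` at the grid of the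
nodes `s_0,…,s_k`. -/
def IsLag (k : ℕ) (s : Fin (k + 1) → ℝ) (v : ℝ × ℝ → ℝ) (q : MvPolynomial (Fin 2) ℝ) :
    Prop :=
  memQ k q ∧ ∀ i j, ev q (s i, s j) = v (s i, s j)

open Polynomial

theorem integral_eval_derivative_mul (f g : ℝ[X]) :
    ∫ x in (-1 : ℝ)..1, (derivative f).eval x * g.eval x =
      f.eval 1 * g.eval 1 - f.eval (-1) * g.eval (-1) -
        ∫ x in (-1 : ℝ)..1, f.eval x * (derivative g).eval x := by
  have h := intervalIntegral.integral_mul_deriv_eq_deriv_mul (a := -1) (b := 1)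
    (fun x _ => f.hasDerivAt x) (fun x _ => g.hasDerivAt x)
    ((derivative f).continuous.intervalIntegrable _ _)
    ((derivative g).continuous.intervalIntegrable _ _)
  linarith

theorem eval_iterate_derivative_eq_zero {p k : ℕ} (hk : k < p) {a : ℝ} (ha : a ^ 2 = 1) :
    (derivative^[k] ((X ^ 2 - 1 : ℝ[X]) ^ p)).eval a = 0 := by
  obtain ⟨q, hq⟩ := pow_sub_dvd_iterate_derivative_pow (X ^ 2 - 1 : ℝ[X]) p k
  rw [hq]
  simp [ha, Nat.sub_ne_zero_of_lt hk]

theorem integral_iterate_derivative_mul_eq_zero (p : ℕ) {k : ℕ} (hk : k ≤ p) :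
    ∀ r : ℝ[X], derivative^[k] r = 0 →
      ∫ x in (-1 : ℝ)..1, (derivative^[k] ((X ^ 2 - 1 : ℝ[X]) ^ p)).eval x * r.eval x = 0 := by
  induction k with
  | zero =>
    intro r hr
    simp only [Function.iterate_zero, id_eq] at hr
    simp [hr]
  | succ k ih =>
    intro r hr
    simp only [Function.iterate_succ_apply'] at hr ⊢
    rw [integral_eval_derivative_mul, ih (by omega) (derivative r)
      (by rw [← Function.iterate_succ_apply, Function.iterate_succ_apply']; exact hr),
      eval_iterate_derivative_eq_zero (by omega) (by norm_num),
      eval_iterate_derivative_eq_zero (by omega) (by norm_num)]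
    simp

theorem integral_legendre_mul_eq_zero {p : ℕ} {r : ℝ[X]} (hr : r.natDegree < p) :
    ∫ x in (-1 : ℝ)..1, (legendre p).eval x * r.eval x = 0 := by
  simp only [legendre, eval_mul, eval_C, mul_assoc, intervalIntegral.integral_const_mul]
  rw [integral_iterate_derivative_mul_eq_zero p le_rfl r
    (iterate_derivative_eq_zero hr), mul_zero]

theorem integral_lobatto_mul_eq_zero {p : ℕ} (hp : 2 ≤ p) {r : ℝ[X]}
    (hr : r.natDegree ≤ p - 2) :
    ∫ x in (-1 : ℝ)..1, ((1 - X ^ 2 : ℝ[X]) * derivative (legendre p)).eval x * r.eval x = 0 := by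
  have h := integral_eval_derivative_mul (legendre p) ((1 - X ^ 2 : ℝ[X]) * r)
  have hd : (derivative ((1 - X ^ 2 : ℝ[X]) * r)).natDegree < p := by
    have h1 := natDegree_derivative_le ((1 - X ^ 2 : ℝ[X]) * r)
    have h2 : ((1 - X ^ 2 : ℝ[X]) * r).natDegree ≤ 2 + (p - 2) := by
      refine natDegree_mul_le_of_le ?_ hr
      compute_degree
    omega
  rw [integral_legendre_mul_eq_zero hd] at h
  simp only [eval_mul, eval_sub, eval_one, eval_pow, eval_X] at h ⊢
  norm_num at h
  rw [← h]
  congr 1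
  ext x
  ring

theorem natDegree_X_sq_sub_one_pow_le (p : ℕ) :
    ((X ^ 2 - 1 : ℝ[X]) ^ p).natDegree ≤ 2 * p := by
  rw [mul_comm]
  refine natDegree_pow_le_of_le p ?_
  compute_degree

theorem natDegree_legendre_le (p : ℕ) : (legendre p).natDegree ≤ p := by
  unfold legendre
  refine (natDegree_C_mul_le _ _).trans ((natDegree_iterate_derivative _ _).trans ?_)
  have := natDegree_X_sq_sub_one_pow_le p
  omega

theorem natDegree_lobatto_le {p : ℕ} (hp : 2 ≤ p) :
    ((1 - X ^ 2 : ℝ[X]) * derivative (legendre p)).natDegree ≤ p + 1 := by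
  have h1 := natDegree_legendre_le p
  have h2 := natDegree_derivative_le (legendre p)
  have h3 : ((1 - X ^ 2 : ℝ[X]) * derivative (legendre p)).natDegree ≤ 2 + (p - 1) := by
    refine natDegree_mul_le_of_le ?_ (by omega)
    compute_degree
  omega

theorem coeff_legendre_self_ne_zero (p : ℕ) : (legendre p).coeff p ≠ 0 := by
  have hm : ((X ^ 2 - 1 : ℝ[X]) ^ p).coeff (p + p) = 1 := by
    have h0 : (X ^ 2 - 1 : ℝ[X]) = X ^ 2 - C 1 := by simp
    have h1 : (X ^ 2 - C 1 : ℝ[X]).Monic := monic_X_pow_sub_C 1 (by norm_num)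
    have h2 := (h1.pow p).coeff_natDegree
    rw [h1.natDegree_pow, natDegree_X_pow_sub_C] at h2
    rw [h0, ← two_mul, mul_comm, h2]
  rw [legendre, coeff_C_mul, coeff_iterate_derivative, hm]
  have : (p + p).descFactorial p ≠ 0 := by
    rw [Ne, Nat.descFactorial_eq_zero_iff_lt]
    omega
  have : ((p + p).descFactorial p : ℝ) ≠ 0 := by exact_mod_cast this
  have := Nat.factorial_ne_zero p
  simp only [nsmul_eq_mul, mul_one]
  positivity

theorem coeff_lobatto_ne_zero {p : ℕ} (hp : 2 ≤ p) :
    ((1 - X ^ 2 : ℝ[X]) * derivative (legendre p)).coeff (p + 1) ≠ 0 := by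
  obtain ⟨q, rfl⟩ : ∃ q, p = q + 1 := ⟨p - 1, by omega⟩
  have h1 := natDegree_legendre_le (q + 1)
  have h2 := coeff_legendre_self_ne_zero (q + 1)
  have h3 : (legendre (q + 1)).coeff (q + 1 + 1 + 1) = 0 :=
    coeff_eq_zero_of_natDegree_lt (by omega)
  rw [sub_mul, one_mul, coeff_sub, coeff_X_pow_mul, coeff_derivative, coeff_derivative, h3]
  have : (q : ℝ) + 1 ≠ 0 := by positivity
  simpa using ⟨h2, this⟩

theorem eq_zero_of_orthogonal {p : ℕ} (hp : 2 ≤ p) {f : ℝ[X]} (hf : f.natDegree ≤ p)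
    (h1 : f.eval 1 = 0) (h2 : f.eval (-1) = 0)
    (ho : ∀ r : ℝ[X], r.natDegree ≤ p - 2 → ∫ x in (-1 : ℝ)..1, f.eval x * r.eval x = 0) :
    f = 0 := by
  obtain ⟨a, rfl⟩ := dvd_iff_isRoot.2 h1
  have h3 : a.IsRoot (-1) := by
    simp only [eval_mul, eval_sub, eval_X, eval_C] at h2
    simpa [IsRoot] using (mul_eq_zero.1 h2).resolve_left (by norm_num)
  obtain ⟨b, rfl⟩ := dvd_iff_isRoot.2 h3
  by_contra hne
  have hb : b ≠ 0 := by
    rintro rfl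
    simp at hne
  have hdeg : b.natDegree ≤ p - 2 := by
    rw [natDegree_mul (X_sub_C_ne_zero _) (mul_ne_zero (X_sub_C_ne_zero _) hb),
      natDegree_mul (X_sub_C_ne_zero _) hb, natDegree_X_sub_C, natDegree_X_sub_C] at hf
    omega
  have hI := ho b hdeg
  obtain ⟨c, hc, hbc⟩ : ∃ c ∈ Set.Ioo (-1 : ℝ) 1, b.eval c ≠ 0 := by
    by_contra! hcon
    exact hb (eq_zero_of_infinite_isRoot b
      ((Set.Ioo_infinite (by norm_num : (-1 : ℝ) < 1)).mono hcon))
  have hpos : 0 < ∫ x in (-1 : ℝ)..1, (1 - x ^ 2) * b.eval x ^ 2 := by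
    refine intervalIntegral.integral_pos (by norm_num) (by fun_prop) ?_
      ⟨c, Set.Ioo_subset_Icc_self hc, ?_⟩
    · intro x hx
      have : 0 ≤ 1 - x ^ 2 := by nlinarith [hx.1, hx.2]
      positivity
    · have : 0 < 1 - c ^ 2 := by nlinarith [hc.1, hc.2]
      positivity
  have hneg : ∫ x in (-1 : ℝ)..1, (1 - x ^ 2) * b.eval x ^ 2 = 0 := by
    rw [← neg_eq_zero, ← intervalIntegral.integral_neg, ← hI]
    congr 1
    ext x
    simp only [eval_mul, eval_sub, eval_X, eval_C]
    ring
  linarith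

/-- A polynomial of degree at most `p + 1` vanishing at `±1` and orthogonal to `P_{p-2}` is a
multiple of `(1 - X²) L_p'`. -/
theorem eval_eq_zero_of_orthogonal {p : ℕ} (hp : 2 ≤ p) {f : ℝ[X]} (hf : f.natDegree ≤ p + 1)
    (h1 : f.eval 1 = 0) (h2 : f.eval (-1) = 0)
    (ho : ∀ r : ℝ[X], r.natDegree ≤ p - 2 → ∫ x in (-1 : ℝ)..1, f.eval x * r.eval x = 0)
    {s : ℝ} (hs : (1 - s ^ 2) * (derivative (legendre p)).eval s = 0) :
    f.eval s = 0 := by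
  set G : ℝ[X] := (1 - X ^ 2 : ℝ[X]) * derivative (legendre p) with hG
  have hGc : G.coeff (p + 1) ≠ 0 := coeff_lobatto_ne_zero hp
  have hGd : G.natDegree ≤ p + 1 := natDegree_lobatto_le hp
  set c : ℝ := f.coeff (p + 1) / G.coeff (p + 1) with hc
  have key : f - C c * G = 0 := by
    refine eq_zero_of_orthogonal hp ?_ ?_ ?_ ?_
    · rw [natDegree_le_iff_coeff_eq_zero]
      intro n hn
      rcases Nat.lt_or_ge (p + 1) n with h | h
      · rw [coeff_sub, coeff_C_mul, coeff_eq_zero_of_natDegree_lt (by omega),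
          coeff_eq_zero_of_natDegree_lt (by omega)]
        simp
      · obtain rfl : n = p + 1 := by omega
        rw [coeff_sub, coeff_C_mul, hc]
        field_simp
        simp
    · simp [hG, h1]
    · simp [hG, h2]
    · intro r hr
      have h3 := integral_lobatto_mul_eq_zero hp hr
      simp only [eval_sub, eval_mul, eval_C, sub_mul, mul_assoc]
      rw [intervalIntegral.integral_sub, ho r hr, intervalIntegral.integral_const_mul]
      · simp only [hG, eval_mul, mul_assoc] at h3 ⊢
        rw [h3]
        simp
      all_goals exact Continuous.intervalIntegrable (by fun_prop) _ _
  rw [sub_eq_zero] at key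
  rw [key]
  simp [hG, hs]

@[fun_prop]
theorem continuous_ev (q : MvPolynomial (Fin 2) ℝ) : Continuous (ev q) := by
  unfold ev
  refine q.continuous_eval.comp ?_
  refine continuous_pi fun i => ?_
  fin_cases i
  · exact continuous_fst
  · exact continuous_snd

theorem ev_sub (q r : MvPolynomial (Fin 2) ℝ) (z : ℝ × ℝ) : ev (q - r) z = ev q z - ev r z := by
  simp [ev]

theorem ev_eq_sum (q : MvPolynomial (Fin 2) ℝ) (z : ℝ × ℝ) :
    ev q z = ∑ m ∈ q.support, q.coeff m * (z.1 ^ m 0 * z.2 ^ m 1) := by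
  simp [ev, MvPolynomial.eval_eq']

/-- The univariate polynomial `x ↦ ∑_m c_m φ(m 1) x^{m 0}` for `q = ∑_m c_m x^{m 0} y^{m 1}`. -/
noncomputable def sliceFst (q : MvPolynomial (Fin 2) ℝ) (φ : ℕ → ℝ) : ℝ[X] :=
  ∑ m ∈ q.support, C (q.coeff m * φ (m 1)) * X ^ m 0

/-- The univariate polynomial `y ↦ ∑_m c_m φ(m 0) y^{m 1}` for `q = ∑_m c_m x^{m 0} y^{m 1}`. -/
noncomputable def sliceSnd (q : MvPolynomial (Fin 2) ℝ) (φ : ℕ → ℝ) : ℝ[X] :=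
  ∑ m ∈ q.support, C (q.coeff m * φ (m 0)) * X ^ m 1

theorem natDegree_sliceFst_le (q : MvPolynomial (Fin 2) ℝ) (φ : ℕ → ℝ) :
    (sliceFst q φ).natDegree ≤ q.degreeOf 0 :=
  natDegree_sum_le_of_forall_le _ _ fun _ hm =>
    (natDegree_C_mul_X_pow_le _ _).trans (MvPolynomial.monomial_le_degreeOf 0 hm)

theorem natDegree_sliceSnd_le (q : MvPolynomial (Fin 2) ℝ) (φ : ℕ → ℝ) :
    (sliceSnd q φ).natDegree ≤ q.degreeOf 1 :=
  natDegree_sum_le_of_forall_le _ _ fun _ hm =>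
    (natDegree_C_mul_X_pow_le _ _).trans (MvPolynomial.monomial_le_degreeOf 1 hm)

theorem eval_sliceFst_pow (q : MvPolynomial (Fin 2) ℝ) (x y : ℝ) :
    (sliceFst q (y ^ ·)).eval x = ev q (x, y) := by
  simp only [sliceFst, ev_eq_sum, eval_finsetSum, eval_mul, eval_C, eval_pow, eval_X]
  exact Finset.sum_congr rfl fun _ _ => by ring

theorem eval_sliceSnd_pow (q : MvPolynomial (Fin 2) ℝ) (x y : ℝ) :
    (sliceSnd q (x ^ ·)).eval y = ev q (x, y) := by
  simp only [sliceSnd, ev_eq_sum, eval_finsetSum, eval_mul, eval_C, eval_pow, eval_X]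
  exact Finset.sum_congr rfl fun _ _ => by ring

theorem eval_sliceFst_integral (q : MvPolynomial (Fin 2) ℝ) (r : ℝ[X]) (x : ℝ) :
    (sliceFst q fun n => ∫ y in (-1 : ℝ)..1, y ^ n * r.eval y).eval x =
      ∫ y in (-1 : ℝ)..1, ev q (x, y) * r.eval y := by
  simp only [sliceFst, ev_eq_sum, eval_finsetSum, eval_mul, eval_C, eval_pow, eval_X,
    Finset.sum_mul]
  rw [intervalIntegral.integral_finsetSum
    fun _ _ => Continuous.intervalIntegrable (by fun_prop) _ _]
  refine Finset.sum_congr rfl fun m _ => ?_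
  rw [mul_right_comm, ← intervalIntegral.integral_const_mul]
  congr 1
  ext y
  ring

theorem degreeOf_aeval_X_le (r : ℝ[X]) (i j : Fin 2) :
    (aeval (MvPolynomial.X i : MvPolynomial (Fin 2) ℝ) r).degreeOf j ≤
      if j = i then r.natDegree else 0 := by
  rw [aeval_eq_sum_range]
  refine (MvPolynomial.degreeOf_sum_le _ _ _).trans (Finset.sup_le fun n hn => ?_)
  rw [MvPolynomial.smul_eq_C_mul]
  refine (MvPolynomial.degreeOf_C_mul_le _ _ _).trans ?_
  refine (MvPolynomial.degreeOf_pow_le _ _ _).trans ?_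
  rw [MvPolynomial.degreeOf_X]
  have := Finset.mem_range.1 hn
  split_ifs <;> omega

theorem exists_memQ_ev_eq_mul {k : ℕ} {r s : ℝ[X]} (hr : r.natDegree ≤ k)
    (hs : s.natDegree ≤ k) :
    ∃ q, memQ k q ∧ ∀ x y, ev q (x, y) = r.eval x * s.eval y := by
  refine ⟨aeval (MvPolynomial.X 0) r * aeval (MvPolynomial.X 1) s, ⟨?_, ?_⟩, fun x y => ?_⟩
  · refine (MvPolynomial.degreeOf_mul_le _ _ _).trans ?_
    have h1 := degreeOf_aeval_X_le r 0 0
    have h2 := degreeOf_aeval_X_le s 1 0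
    simp only [if_true, zero_ne_one, if_false] at h1 h2
    omega
  · refine (MvPolynomial.degreeOf_mul_le _ _ _).trans ?_
    have h1 := degreeOf_aeval_X_le r 0 1
    have h2 := degreeOf_aeval_X_le s 1 1
    simp only [if_true, one_ne_zero, if_false] at h1 h2
    omega
  · have h (i : Fin 2) (f : ℝ[X]) : MvPolynomial.eval ![x, y] (aeval (MvPolynomial.X i) f) =
        f.eval (![x, y] i) := by
      rw [← MvPolynomial.coe_aeval_eq_eval, RingHom.coe_coe, ← aeval_algHom_apply,
        MvPolynomial.aeval_X, coe_aeval_eq_eval]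
    simp [ev, h]

theorem memQ.sub {k : ℕ} {q r : MvPolynomial (Fin 2) ℝ} (hq : memQ k q) (hr : memQ k r) :
    memQ k (q - r) :=
  ⟨(MvPolynomial.degreeOf_sub_le _ _ _).trans (max_le hq.1 hr.1),
    (MvPolynomial.degreeOf_sub_le _ _ _).trans (max_le hq.2 hr.2)⟩

theorem memQ.mono {k l : ℕ} (hkl : k ≤ l) {q : MvPolynomial (Fin 2) ℝ} (hq : memQ k q) :
    memQ l q :=
  ⟨hq.1.trans hkl, hq.2.trans hkl⟩

theorem IsVEC.congr {k : ℕ} {v w : ℝ × ℝ → ℝ} (h : ∀ z ∈ refSq, v z = w z)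
    {q : MvPolynomial (Fin 2) ℝ} (hq : IsVEC k v q) : IsVEC k w q := by
  have hI : ∀ s ∈ Set.uIcc (-1 : ℝ) 1, s ∈ Set.Icc (-1 : ℝ) 1 := fun s hs => by
    rwa [Set.uIcc_of_le (by norm_num)] at hs
  have hP : ∀ a ∈ ({-1, 1} : Set ℝ), a ∈ Set.Icc (-1 : ℝ) 1 := by
    rintro a (rfl | rfl) <;> norm_num
  have hm : ∀ a ∈ Set.Icc (-1 : ℝ) 1, ∀ b ∈ Set.Icc (-1 : ℝ) 1, w (a, b) = v (a, b) :=
    fun a ha b hb => (h _ ⟨⟨ha.1, hb.1⟩, ⟨ha.2, hb.2⟩⟩).symm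
  obtain ⟨h0, h1, h2, h3, h4⟩ := hq
  refine ⟨h0, fun a ha b hb => ?_, fun b hb r hr => ?_, fun a ha r hr => ?_, fun r hr => ?_⟩
  · rw [hm a (hP a ha) b (hP b hb), h1 a ha b hb]
  · rw [← h2 b hb r hr]
    refine intervalIntegral.integral_congr fun s hs => ?_
    simp only [hm s (hI s hs) b (hP b hb)]
  · rw [← h3 a ha r hr]
    refine intervalIntegral.integral_congr fun s hs => ?_
    simp only [hm a (hP a ha) s (hI s hs)]
  · rw [← h4 r hr]
    refine intervalIntegral.integral_congr fun x hx => ?_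
    refine intervalIntegral.integral_congr fun y hy => ?_
    simp only [hm x (hI x hx) y (hI y hy)]

/-- A continuous function on the reference square extends continuously to the plane. -/
theorem exists_continuous_eqOn_refSq {v : ℝ × ℝ → ℝ} (hv : ContinuousOn v refSq) :
    ∃ w : ℝ × ℝ → ℝ, Continuous w ∧ ∀ z ∈ refSq, v z = w z := by
  have h : (-1 : ℝ) ≤ 1 := by norm_num
  refine ⟨fun z => v (Set.projIcc (-1) 1 h z.1, Set.projIcc (-1) 1 h z.2), ?_, ?_⟩
  · refine hv.comp_continuous ?_ fun z => ?_
    · exact ((continuous_subtype_val.comp continuous_projIcc).comp continuous_fst).prodMk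
        ((continuous_subtype_val.comp continuous_projIcc).comp continuous_snd)
    · have h1 := (Set.projIcc (-1) 1 h z.1).2
      have h2 := (Set.projIcc (-1) 1 h z.2).2
      exact ⟨⟨h1.1, h2.1⟩, ⟨h1.2, h2.2⟩⟩
  · rintro ⟨x, y⟩ ⟨⟨hx, hy⟩, ⟨hx', hy'⟩⟩
    simp only
    rw [Set.projIcc_of_mem h ⟨hx, hx'⟩, Set.projIcc_of_mem h ⟨hy, hy'⟩]

theorem IsVEC.sub {k l : ℕ} (hkl : k ≤ l) {v : ℝ × ℝ → ℝ} (hv : Continuous v)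
    {q r : MvPolynomial (Fin 2) ℝ} (hq : IsVEC l v q) (hr : IsVEC k v r) :
    memQ l (q - r) ∧
    (∀ a ∈ ({-1, 1} : Set ℝ), ∀ b ∈ ({-1, 1} : Set ℝ), ev (q - r) (a, b) = 0) ∧
    (∀ b ∈ ({-1, 1} : Set ℝ), ∀ f : ℝ[X], f.natDegree ≤ k - 2 →
      ∫ s in (-1 : ℝ)..1, ev (q - r) (s, b) * f.eval s = 0) ∧
    (∀ a ∈ ({-1, 1} : Set ℝ), ∀ f : ℝ[X], f.natDegree ≤ k - 2 →
      ∫ s in (-1 : ℝ)..1, ev (q - r) (a, s) * f.eval s = 0) ∧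
    (∀ f : MvPolynomial (Fin 2) ℝ, memQ (k - 2) f →
      ∫ x in (-1 : ℝ)..1, ∫ y in (-1 : ℝ)..1, ev (q - r) (x, y) * ev f (x, y) = 0) := by
  obtain ⟨q0, q1, q2, q3, q4⟩ := hq
  obtain ⟨r0, r1, r2, r3, r4⟩ := hr
  have hkl' : k - 2 ≤ l - 2 := by omega
  refine ⟨q0.sub (r0.mono hkl), fun a ha b hb => ?_, fun b hb f hf => ?_, fun a ha f hf => ?_,
    fun f hf => ?_⟩
  · rw [ev_sub, q1 a ha b hb, r1 a ha b hb, sub_self]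
  · rw [← sub_zero (0 : ℝ)]
    nth_rewrite 1 [← q2 b hb f (hf.trans hkl')]
    rw [← r2 b hb f hf, ← intervalIntegral.integral_sub]
    · congr 1
      ext s
      rw [ev_sub]
      ring
    all_goals exact Continuous.intervalIntegrable (by fun_prop) _ _
  · rw [← sub_zero (0 : ℝ)]
    nth_rewrite 1 [← q3 a ha f (hf.trans hkl')]
    rw [← r3 a ha f hf, ← intervalIntegral.integral_sub]
    · congr 1
      ext s
      rw [ev_sub]
      ring
    all_goals exact Continuous.intervalIntegrable (by fun_prop) _ _
  · have hc : ∀ g : MvPolynomial (Fin 2) ℝ, Continuous fun x : ℝ =>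
        ∫ y in (-1 : ℝ)..1, (ev g (x, y) - v (x, y)) * ev f (x, y) := fun g =>
      intervalIntegral.continuous_parametric_intervalIntegral_of_continuous'
        (by simp only [Function.uncurry_def]; fun_prop) _ _
    rw [← sub_zero (0 : ℝ)]
    nth_rewrite 1 [← q4 f (hf.mono hkl')]
    rw [← r4 f hf, ← intervalIntegral.integral_sub ((hc q).intervalIntegrable _ _)
      ((hc r).intervalIntegrable _ _)]
    congr 1
    ext x
    rw [← intervalIntegral.integral_sub]
    · congr 1
      ext y
      rw [ev_sub]
      ring
    all_goals exact Continuous.intervalIntegrable (by fun_prop) _ _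

theorem ev_eq_zero_of_lobatto {p : ℕ} (hp : 2 ≤ p) {E : MvPolynomial (Fin 2) ℝ}
    (hE : memQ (p + 1) E)
    (hvert : ∀ a ∈ ({-1, 1} : Set ℝ), ∀ b ∈ ({-1, 1} : Set ℝ), ev E (a, b) = 0)
    (hfst : ∀ b ∈ ({-1, 1} : Set ℝ), ∀ f : ℝ[X], f.natDegree ≤ p - 2 →
      ∫ s in (-1 : ℝ)..1, ev E (s, b) * f.eval s = 0)
    (hsnd : ∀ a ∈ ({-1, 1} : Set ℝ), ∀ f : ℝ[X], f.natDegree ≤ p - 2 →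
      ∫ s in (-1 : ℝ)..1, ev E (a, s) * f.eval s = 0)
    (hcell : ∀ f : MvPolynomial (Fin 2) ℝ, memQ (p - 2) f →
      ∫ x in (-1 : ℝ)..1, ∫ y in (-1 : ℝ)..1, ev E (x, y) * ev f (x, y) = 0)
    {s u : ℝ} (hs : (1 - s ^ 2) * (derivative (legendre p)).eval s = 0)
    (hu : (1 - u ^ 2) * (derivative (legendre p)).eval u = 0) :
    ev E (s, u) = 0 := by
  have hedge : ∀ b ∈ ({-1, 1} : Set ℝ), ev E (s, b) = 0 := by
    intro b hb
    rw [← eval_sliceFst_pow]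
    refine eval_eq_zero_of_orthogonal hp ((natDegree_sliceFst_le _ _).trans hE.1) ?_ ?_ ?_ hs
    · rw [eval_sliceFst_pow, hvert 1 (by simp) b hb]
    · rw [eval_sliceFst_pow, hvert (-1) (by simp) b hb]
    · simpa only [eval_sliceFst_pow] using hfst b hb
  rw [← eval_sliceSnd_pow]
  refine eval_eq_zero_of_orthogonal hp ((natDegree_sliceSnd_le _ _).trans hE.2) ?_ ?_ ?_ hu
  · rw [eval_sliceSnd_pow, hedge 1 (by simp)]
  · rw [eval_sliceSnd_pow, hedge (-1) (by simp)]
  · intro r hr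
    simp only [eval_sliceSnd_pow]
    rw [← eval_sliceFst_integral]
    refine eval_eq_zero_of_orthogonal hp ((natDegree_sliceFst_le _ _).trans hE.1) ?_ ?_ ?_ hs
    · rw [eval_sliceFst_integral, hsnd 1 (by simp) r hr]
    · rw [eval_sliceFst_integral, hsnd (-1) (by simp) r hr]
    · intro g hg
      obtain ⟨q, hq, hqe⟩ := exists_memQ_ev_eq_mul hg hr
      rw [← hcell q hq]
      congr 1
      ext x
      rw [eval_sliceFst_integral, ← intervalIntegral.integral_mul_const]
      congr 1
      ext y
      rw [hqe]
      ring

theorem eq_of_ev_eq_on_grid {p : ℕ} {t : Fin (p + 1) → ℝ} (ht : Function.Injective t)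
    {q r : MvPolynomial (Fin 2) ℝ} (hq : memQ p q) (hr : memQ p r)
    (h : ∀ i j, ev q (t i, t j) = ev r (t i, t j)) : q = r := by
  rw [← sub_eq_zero]
  refine MvPolynomial.eq_zero_of_eval_zero_at_prod_finset _
    (fun _ => Finset.univ.image t) (fun i => ?_) fun x hx => ?_
  · rw [Finset.card_image_of_injective _ ht, Finset.card_univ, Fintype.card_fin,
      Nat.lt_succ_iff]
    fin_cases i
    · exact (hq.sub hr).1
    · exact (hq.sub hr).2
  · obtain ⟨i, -, hi⟩ := Finset.mem_image.1 (hx 0)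
    obtain ⟨j, -, hj⟩ := Finset.mem_image.1 (hx 1)
    have hx' : x = ![t i, t j] := by
      ext k
      fin_cases k
      · exact hi.symm
      · exact hj.symm
    have := h i j
    simp only [ev] at this
    rw [hx', map_sub, this, sub_self]

/-- `π̂_p v = Î_p (π̂_{p+1} v)`: the vertex-edge-cell interpolant into `Q_p(τ̂)` equals
the Gauß–Lobatto interpolant of the vertex-edge-cell interpolant into `Q_{p+1}(τ̂)`. -/
theorem vec_eq_gl_of_vec_succ (p : ℕ) (hp : 2 ≤ p)
    (t : Fin (p + 1) → ℝ) (ht : IsGLNodes p t)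
    (v : ℝ × ℝ → ℝ) (hv : ContinuousOn v refSq)
    (qp qP qI : MvPolynomial (Fin 2) ℝ)
    (hqp : IsVEC p v qp) (hqP : IsVEC (p + 1) v qP)
    (hqI : IsLag p t (ev qP) qI) :
    qp = qI := by
  obtain ⟨w, hw, hvw⟩ := exists_continuous_eqOn_refSq hv
  obtain ⟨h0, h1, h2, h3, h4⟩ := (hqP.congr hvw).sub (Nat.le_succ p) hw (hqp.congr hvw)
  obtain ⟨hmono, -, -, hroot⟩ := ht
  refine eq_of_ev_eq_on_grid hmono.injective hqp.1 hqI.1 fun i j => ?_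
  have h := ev_eq_zero_of_lobatto hp h0 h1 h2 h3 h4 (hroot i) (hroot j)
  rw [ev_sub, sub_eq_zero] at h
  rw [hqI.2 i j, h]
end
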